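/- arXiv:0803.1947 — 3 statements merged into one kernel-verified Lean document; each statement's English description precedes it below -/
import Mathlib

section
/- The property Sfin(Γ,Ω) is linearly-σ-additive: if X₁ ⊆ X₂ ⊆ X₃ ⊆ ⋯ is an increasing sequence of subsets of a topological space such that each Xₙ, with the subspace topology, satisfies Sfin(Γ,Ω), then the union ⋃ₙ Xₙ, with the subspace topology, satisfies Sfin(Γ,Ω). -/
open Set

variable (X : Type*) [TopologicalSpace X]

/-- `𝒰` is an open cover of the space `X`: a family of open sets covering `X`. -/
def IsOpenCoverOf (𝒰 : Set (Set X)) : Prop :=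
  (∀ U ∈ 𝒰, IsOpen U) ∧ ∀ x : X, ∃ U ∈ 𝒰, x ∈ U

/-- `𝒰` is an ω-cover of `X`: an open cover not containing `X` itself,
such that every finite subset of `X` is contained in some member of `𝒰`. -/
def IsOmegaCoverOf (𝒰 : Set (Set X)) : Prop :=
  IsOpenCoverOf X 𝒰 ∧ Set.univ ∉ 𝒰 ∧ ∀ F : Set X, F.Finite → ∃ U ∈ 𝒰, F ⊆ U

/-- `𝒰` is a γ-cover of `X`: an infinite open cover such that every point of `X`
belongs to all but finitely many members of `𝒰`. -/
def IsGammaCoverOf (𝒰 : Set (Set X)) : Prop :=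
  IsOpenCoverOf X 𝒰 ∧ 𝒰.Infinite ∧ ∀ x : X, {U ∈ 𝒰 | x ∉ U}.Finite

/-- The selection principle `S₁(A, B)`: for every sequence of covers from class `A`,
one can pick one member from each so that the chosen sets form a cover from class `B`. -/
def S1 (A B : Set (Set X) → Prop) : Prop :=
  ∀ 𝒰 : ℕ → Set (Set X), (∀ n, A (𝒰 n)) →
    ∃ U : ℕ → Set X, (∀ n, U n ∈ 𝒰 n) ∧ B (Set.range U)

/-- The selection principle `Sfin(A, B)`: for every sequence of covers from class `A`,
one can pick finite subfamilies whose union is a cover from class `B`. -/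
def Sfin (A B : Set (Set X) → Prop) : Prop :=
  ∀ 𝒰 : ℕ → Set (Set X), (∀ n, A (𝒰 n)) →
    ∃ F : ℕ → Set (Set X), (∀ n, F n ⊆ 𝒰 n ∧ (F n).Finite) ∧ B (⋃ n, F n)

/-- The selection principle `Ufin(Γ, B)`: for every sequence of open covers of `X`,
none of which contains a finite subfamily covering `X`, one can pick finite
subfamilies `F n` such that the family of unions `⋃₀ F n` belongs to class `B`. -/
def Ufin (B : Set (Set X) → Prop) : Prop :=
  ∀ 𝒰 : ℕ → Set (Set X),
    (∀ n, IsOpenCoverOf X (𝒰 n) ∧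
      ¬ ∃ F ⊆ 𝒰 n, F.Finite ∧ ∀ x : X, ∃ U ∈ F, x ∈ U) →
    ∃ F : ℕ → Set (Set X), (∀ n, F n ⊆ 𝒰 n ∧ (F n).Finite) ∧
      B (Set.range fun n => ⋃₀ F n)

section

variable {Y A : Type*} [TopologicalSpace Y] [TopologicalSpace A]

/-- Removing the whole space from a γ-cover leaves a γ-cover. -/
lemma IsGammaCoverOf.diff_univ {𝒰 : Set (Set Y)} (h : IsGammaCoverOf Y 𝒰) :
    IsGammaCoverOf Y (𝒰 \ {univ}) := by
  obtain ⟨⟨hopen, -⟩, hinf, hfin⟩ := h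
  have hinf' : (𝒰 \ {univ}).Infinite := hinf.sdiff (finite_singleton univ)
  refine ⟨⟨fun U hU => hopen U hU.1, fun x => ?_⟩, hinf', fun x => ?_⟩
  · obtain ⟨U, hU, hx⟩ := (hinf'.sdiff (hfin x)).nonempty
    exact ⟨U, hU, by_contra fun hxU => hx ⟨hU.1, hxU⟩⟩
  · exact (hfin x).subset fun U hU => ⟨hU.1.1, hU.2⟩

/-- The preimages of the members of a γ-cover under a continuous map form a γ-cover,
provided that no member contains the range of the map. -/
lemma IsGammaCoverOf.image_preimage {𝒰 : Set (Set Y)} (h : IsGammaCoverOf Y 𝒰)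
    {f : A → Y} (hf : Continuous f) (hne : ∀ U ∈ 𝒰, f ⁻¹' U ≠ univ) :
    IsGammaCoverOf A (preimage f '' 𝒰) := by
  obtain ⟨⟨hopen, hcov⟩, hinf, hfin⟩ := h
  refine ⟨⟨?_, fun a => ?_⟩, fun himg => hinf ?_, fun a => ?_⟩
  · rintro _ ⟨U, hU, rfl⟩
    exact (hopen U hU).preimage hf
  · obtain ⟨U, hU, ha⟩ := hcov (f a)
    exact ⟨_, mem_image_of_mem _ hU, ha⟩
  · refine himg.of_finite_fibers (f := preimage f) ?_
    rintro _ ⟨U, hU, rfl⟩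
    obtain ⟨a, ha⟩ := (ne_univ_iff_exists_notMem _).1 (hne U hU)
    refine (hfin (f a)).subset ?_
    rintro V ⟨hV, hVU⟩
    refine ⟨hV, fun hmem => ha ?_⟩
    rw [← show f ⁻¹' V = f ⁻¹' U from hVU]
    exact hmem
  · refine ((hfin (f a)).image (preimage f)).subset ?_
    rintro _ ⟨⟨U, hU, rfl⟩, ha⟩
    exact ⟨U, ⟨hU, ha⟩, rfl⟩

/-- If `A` satisfies `Sfin(Γ, Ω)` and maps continuously to `Y`, then from every sequence of
γ-covers of `Y` one can pick finite subfamilies such that the image of every finite subset of `A`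
is contained in a chosen set. -/
lemma Sfin.exists_finite_subfamilies (hA : Sfin A (IsGammaCoverOf A) (IsOmegaCoverOf A))
    {f : A → Y} (hf : Continuous f) {𝒰 : ℕ → Set (Set Y)} (h𝒰 : ∀ k, IsGammaCoverOf Y (𝒰 k)) :
    ∃ F : ℕ → Set (Set Y), (∀ k, F k ⊆ 𝒰 k ∧ (F k).Finite) ∧
      ∀ E : Set A, E.Finite → ∃ U ∈ ⋃ k, F k, f '' E ⊆ U := by
  by_cases hne : ∀ k, ∀ U ∈ 𝒰 k, f ⁻¹' U ≠ univ
  · obtain ⟨G, hG, -, -, hω⟩ := hA _ fun k => (h𝒰 k).image_preimage hf (hne k)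
    choose F hF𝒰 hFfin hFG using fun k =>
      exists_subset_image_finite_and.1 ⟨G k, (hG k).1, (hG k).2, Eq.refl (G k)⟩
    refine ⟨F, fun k => ⟨hF𝒰 k, hFfin k⟩, fun E hE => ?_⟩
    obtain ⟨W, hW, hEW⟩ := hω E hE
    obtain ⟨k, hk⟩ := mem_iUnion.1 hW
    rw [hFG k] at hk
    obtain ⟨U, hU, rfl⟩ := hk
    exact ⟨U, mem_iUnion.2 ⟨k, hU⟩, image_subset_iff.2 hEW⟩
  · push Not at hne
    obtain ⟨k, U, hU, hfU⟩ := hne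
    refine ⟨fun j => {V | V = U ∧ j = k}, fun j => ⟨?_, ?_⟩, fun E _ => ⟨U, ?_, ?_⟩⟩
    · rintro V ⟨rfl, rfl⟩
      exact hU
    · exact (finite_singleton U).subset fun V hV => hV.1
    · exact mem_iUnion.2 ⟨k, rfl, rfl⟩
    · exact image_subset_iff.2 (hfU ▸ subset_univ E)

end

theorem sfin_gamma_omega_linearly_sigma_additive {α : Type*} [TopologicalSpace α] (X : ℕ → Set α)
    (hmono : ∀ n, X n ⊆ X (n + 1))
    (h : ∀ n, Sfin (X n) (IsGammaCoverOf (X n)) (IsOmegaCoverOf (X n))) :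
    Sfin (⋃ n, X n) (IsGammaCoverOf (⋃ n, X n)) (IsOmegaCoverOf (⋃ n, X n)) := by
  have hX : Monotone X := monotone_nat_of_le_succ hmono
  intro 𝒰 h𝒰
  choose F hF hFω using fun m => (h m).exists_finite_subfamilies
    (continuous_inclusion (subset_iUnion X m)) fun k => (h𝒰 (Nat.pair m k)).diff_univ
  have key : ∀ E : Set (⋃ n, X n), E.Finite →
      ∃ U ∈ ⋃ n : ℕ, F n.unpair.1 n.unpair.2, E ⊆ U := by
    intro E hE
    have hm : ∃ m, ∀ x ∈ E, (x : α) ∈ X m := by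
      choose i hi using fun x : ⋃ n, X n => mem_iUnion.1 x.2
      obtain ⟨m, hm⟩ := (hE.image i).bddAbove
      exact ⟨m, fun x hx => hX (hm (mem_image_of_mem i hx)) (hi x)⟩
    obtain ⟨m, hm⟩ := hm
    obtain ⟨U, hU, hEU⟩ := hFω m (inclusion (subset_iUnion X m) ⁻¹' E)
      (hE.preimage (inclusion_injective _).injOn)
    obtain ⟨k, hk⟩ := mem_iUnion.1 hU
    refine ⟨U, mem_iUnion.2 ⟨Nat.pair m k, by simpa using hk⟩, fun x hx => ?_⟩
    exact hEU ⟨⟨x, hm x hx⟩, hx, rfl⟩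
  have hsub : ∀ n, F n.unpair.1 n.unpair.2 ⊆ 𝒰 n \ {univ} := fun n => by
    simpa using (hF n.unpair.1 n.unpair.2).1
  refine ⟨fun n => F n.unpair.1 n.unpair.2,
    fun n => ⟨(hsub n).trans sdiff_subset, (hF _ _).2⟩, ⟨fun U hU => ?_, fun x => ?_⟩, ?_, key⟩
  · obtain ⟨n, hn⟩ := mem_iUnion.1 hU
    exact (h𝒰 n).1.1 U (hsub n hn).1
  · obtain ⟨U, hU, hxU⟩ := key {x} (finite_singleton x)
    exact ⟨U, hU, hxU rfl⟩
  · intro huniv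
    obtain ⟨n, hn⟩ := mem_iUnion.1 huniv
    exact (hsub n hn).2 rfl
end

section
/- The property S₁(Ω,Ω) is linearly-σ-additive: if X₁ ⊆ X₂ ⊆ X₃ ⊆ ⋯ is an increasing sequence of subsets of a topological space such that each Xₙ, with the subspace topology, satisfies S₁(Ω,Ω), then the union ⋃ₙ Xₙ, with the subspace topology, satisfies S₁(Ω,Ω). -/
open Set

variable (X : Type*) [TopologicalSpace X]

/-- A space satisfying `S₁(Ω, Ω)` that maps continuously to `Y` selects, from every sequence of
ω-covers of `Y`, members that capture the images of all its finite subsets. -/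
theorem exists_selection_of_continuous {Y Z : Type*} [TopologicalSpace Y] [TopologicalSpace Z]
    (hZ : S1 Z (IsOmegaCoverOf Z) (IsOmegaCoverOf Z)) {f : Z → Y} (hf : Continuous f)
    {𝒱 : ℕ → Set (Set Y)} (h𝒱 : ∀ k, IsOmegaCoverOf Y (𝒱 k)) :
    ∃ U : ℕ → Set Y, (∀ k, U k ∈ 𝒱 k) ∧ ∀ F : Set Z, F.Finite → ∃ k, F ⊆ f ⁻¹' U k := by
  have hne : ∀ k, ∃ V, V ∈ 𝒱 k := fun k =>
    let ⟨V, hV, _⟩ := (h𝒱 k).2.2 ∅ Set.finite_empty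
    ⟨V, hV⟩
  choose V₀ hV₀ using hne
  by_cases hfull : ∃ k, ∃ V ∈ 𝒱 k, f ⁻¹' V = Set.univ
  · obtain ⟨k, V, hV, hVf⟩ := hfull
    refine ⟨Function.update V₀ k V, fun j => ?_, fun F _ => ⟨k, by simp [hVf]⟩⟩
    obtain rfl | hj := eq_or_ne j k
    · simpa using hV
    · simpa [hj] using hV₀ j
  · push Not at hfull
    have hcover : ∀ k, IsOmegaCoverOf Z ((f ⁻¹' ·) '' 𝒱 k) := by
      refine fun k => ⟨⟨?_, fun z => ?_⟩, ?_, fun F hF => ?_⟩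
      · rintro _ ⟨V, hV, rfl⟩
        exact ((h𝒱 k).1.1 V hV).preimage hf
      · obtain ⟨V, hV, hz⟩ := (h𝒱 k).1.2 (f z)
        exact ⟨_, ⟨V, hV, rfl⟩, hz⟩
      · rintro ⟨V, hV, h⟩
        exact hfull k V hV h
      · obtain ⟨V, hV, hFV⟩ := (h𝒱 k).2.2 (f '' F) (hF.image f)
        exact ⟨_, ⟨V, hV, rfl⟩, Set.image_subset_iff.1 hFV⟩
    obtain ⟨W, hW, hWcover⟩ := hZ _ hcover
    choose U hU hUW using hW
    refine ⟨U, hU, fun F hF => ?_⟩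
    obtain ⟨_, ⟨k, rfl⟩, hk⟩ := hWcover.2.2 F hF
    exact ⟨k, hk.trans (hUW k).ge⟩

theorem s1_omega_omega_linearly_sigma_additive {α : Type*} [TopologicalSpace α] (X : ℕ → Set α)
    (hmono : ∀ n, X n ⊆ X (n + 1))
    (h : ∀ n, S1 (X n) (IsOmegaCoverOf (X n)) (IsOmegaCoverOf (X n))) :
    S1 (⋃ n, X n) (IsOmegaCoverOf (⋃ n, X n)) (IsOmegaCoverOf (⋃ n, X n)) := by
  intro 𝒰 h𝒰
  have hsub : ∀ n, X n ⊆ ⋃ n, X n := Set.subset_iUnion X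
  choose U hU hUfin using fun n => exists_selection_of_continuous (h n)
    (continuous_inclusion (hsub n)) (𝒱 := fun k => 𝒰 (Nat.pair n k)) fun k => h𝒰 _
  have hsel : ∀ m, U m.unpair.1 m.unpair.2 ∈ 𝒰 m := fun m => by
    simpa using hU m.unpair.1 m.unpair.2
  have hfin : ∀ F : Set (⋃ n, X n), F.Finite →
      ∃ V ∈ Set.range fun m : ℕ => U m.unpair.1 m.unpair.2, F ⊆ V := by
    intro F hF
    obtain ⟨n, hn⟩ : ∃ n, Subtype.val '' F ⊆ X n := by
      have hF' := hF.image Subtype.val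
      rw [← hF'.coe_toFinset]
      have hdir := (monotone_nat_of_le_succ hmono).directed_le
      refine hdir.exists_mem_subset_of_finset_subset_biUnion ?_
      rw [hF'.coe_toFinset]
      exact Subtype.coe_image_subset _ F
    obtain ⟨k, hk⟩ := hUfin n (Set.inclusion (hsub n) ⁻¹' F)
      (hF.preimage (Set.inclusion_injective (hsub n)).injOn)
    refine ⟨_, ⟨Nat.pair n k, rfl⟩, fun x hx => ?_⟩
    have hxk : (⟨x, hn ⟨x, hx, rfl⟩⟩ : X n) ∈ Set.inclusion (hsub n) ⁻¹' U n k := hk hx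
    simpa using hxk
  refine ⟨fun m => U m.unpair.1 m.unpair.2, hsel, ⟨?_, fun x => ?_⟩, ?_, hfin⟩
  · rintro _ ⟨m, rfl⟩
    exact (h𝒰 m).1.1 _ (hsel m)
  · obtain ⟨V, hV, hxV⟩ := hfin {x} (Set.finite_singleton x)
    exact ⟨V, hV, hxV rfl⟩
  · rintro ⟨m, hm⟩
    exact (h𝒰 m).2.1 (hm ▸ hsel m)
end

section
/- The Hurewicz property Ufin(Γ,Γ) is linearly-σ-additive: if X₁ ⊆ X₂ ⊆ X₃ ⊆ ⋯ is an increasing sequence of subsets of a topological space such that each Xₙ, with the subspace topology, satisfies Ufin(Γ,Γ), then the union ⋃ₙ Xₙ, with the subspace topology, satisfies Ufin(Γ,Γ). -/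
open Set

variable (X : Type*) [TopologicalSpace X]

open Filter

/-- A sequence with infinite range has a subsequence without repetitions. -/
theorem exists_strictMono_injective_comp {β : Type*} {g : ℕ → β} (hg : (range g).Infinite) :
    ∃ φ : ℕ → ℕ, StrictMono φ ∧ Function.Injective (g ∘ φ) := by
  have e := hg.natEmbedding
  choose ψ hψ using fun k => (e k).2
  have hinj : Function.Injective (g ∘ ψ) := fun a b hab =>
    e.injective (Subtype.ext (by simpa only [Function.comp_apply, hψ] using hab))
  have htend : Tendsto ψ atTop atTop := by
    simpa only [Nat.cofinite_eq_atTop] using hinj.of_comp.tendsto_cofinite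
  obtain ⟨φ, hφ, hψφ⟩ := strictMono_subseq_of_tendsto_atTop htend
  exact ⟨ψ ∘ φ, hψφ, hinj.comp hφ.injective⟩

/-- The open sets refining each of the pullbacks under `f` of the first `n + 1` open covers
form an open cover. -/
theorem isOpenCoverOf_refinement {Z Y : Type*} [TopologicalSpace Z] [TopologicalSpace Y]
    {f : Z → Y} (hf : Continuous f) {𝒰 : ℕ → Set (Set Y)} (h𝒰 : ∀ n, IsOpenCoverOf Y (𝒰 n))
    (n : ℕ) :
    IsOpenCoverOf Z {V | IsOpen V ∧ ∀ i ≤ n, ∃ U ∈ 𝒰 i, V ⊆ f ⁻¹' U} := by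
  refine ⟨fun V hV => hV.1, fun z => ?_⟩
  choose U hU hzU using fun i => (h𝒰 i).2 (f z)
  refine ⟨⋂ i ∈ Iic n, f ⁻¹' U i, ⟨?_, fun i hi => ⟨U i, hU i, biInter_subset_of_mem hi⟩⟩, ?_⟩
  · exact (finite_Iic n).isOpen_biInter fun i _ => ((h𝒰 i).1 _ (hU i)).preimage hf
  · exact mem_iInter₂.2 fun i _ => hzU i

/-- For a continuous map from a Hurewicz space, arbitrary open covers of the codomain admit
finite subfamilies whose unions eventually contain each point of the image. -/
theorem exists_finite_subfamilies_eventually_mem {Z Y : Type*} [TopologicalSpace Z]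
    [TopologicalSpace Y] (hZ : Ufin Z (IsGammaCoverOf Z)) {f : Z → Y} (hf : Continuous f)
    {𝒰 : ℕ → Set (Set Y)} (h𝒰 : ∀ n, IsOpenCoverOf Y (𝒰 n)) :
    ∃ F : ℕ → Set (Set Y), (∀ n, F n ⊆ 𝒰 n ∧ (F n).Finite) ∧
      ∀ z, ∀ᶠ n in atTop, f z ∈ ⋃₀ F n := by
  by_cases hgood : ∀ n, ∃ F ⊆ 𝒰 n, F.Finite ∧ ∀ z, f z ∈ ⋃₀ F
  · choose F hsub hfin hcov using hgood
    exact ⟨F, fun n => ⟨hsub n, hfin n⟩, fun z => Eventually.of_forall fun n => hcov n z⟩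
  obtain ⟨m, hm⟩ := not_forall.1 hgood
  obtain ⟨G, hG, -, hinf, hmem⟩ := hZ
    (fun n => {V | IsOpen V ∧ ∀ i ≤ m + n, ∃ U ∈ 𝒰 i, V ⊆ f ⁻¹' U}) fun n => by
      refine ⟨isOpenCoverOf_refinement hf h𝒰 _, ?_⟩
      rintro ⟨F, hF, hfin, hcov⟩
      choose! r hr hVr using fun V (hV : V ∈ F) => (hF hV).2 m (Nat.le_add_right m n)
      refine hm ⟨r '' F, image_subset_iff.2 hr, hfin.image r, fun z => ?_⟩
      obtain ⟨V, hV, hz⟩ := hcov z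
      exact ⟨r V, mem_image_of_mem r hV, hVr V hV hz⟩
  obtain ⟨φ, hφ, hinj⟩ := exists_strictMono_injective_comp hinf
  choose! r hr hVr using fun n V (hV : V ∈ G (φ n)) =>
    ((hG (φ n)).1 hV).2 n ((hφ.le_apply).trans (Nat.le_add_left _ m))
  refine ⟨fun n => r n '' G (φ n), fun n =>
    ⟨image_subset_iff.2 (hr n), (hG (φ n)).2.image _⟩, fun z => ?_⟩
  have hfin := (hmem z).preimage (hinj.injOn)
  rw [← Nat.cofinite_eq_atTop]
  refine hfin.subset fun n hn => ⟨mem_range_self _, fun hz => hn ?_⟩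
  obtain ⟨V, hV, hzV⟩ := hz
  exact ⟨r n V, mem_image_of_mem _ hV, hVr n V hV hzV⟩

/-- A sequence of proper open subsets eventually containing each point has a γ-cover as range. -/
theorem isGammaCoverOf_range {Y : Type*} [TopologicalSpace Y] {W : ℕ → Set Y}
    (hopen : ∀ n, IsOpen (W n)) (hne : ∀ n, W n ≠ univ)
    (hmem : ∀ y, ∀ᶠ n in atTop, y ∈ W n) : IsGammaCoverOf Y (range W) := by
  refine ⟨⟨forall_mem_range.2 hopen, fun y => ?_⟩, fun hfin => ?_, fun y => ?_⟩
  · obtain ⟨n, hn⟩ := (hmem y).exists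
    exact ⟨W n, mem_range_self n, hn⟩
  · have := hfin.to_subtype
    obtain ⟨⟨_, n, rfl⟩, hn⟩ := Finite.exists_infinite_fiber (rangeFactorization W)
    refine hne n (eq_univ_of_forall fun y => ?_)
    have hfreq := Nat.frequently_atTop_iff_infinite.2 (infinite_coe_iff.1 hn)
    obtain ⟨k, hk, hy⟩ := (hfreq.and_eventually (hmem y)).exists
    have hkn : W k = W n := congrArg Subtype.val hk
    exact hkn ▸ hy
  · have hfin : {n | y ∉ W n}.Finite := by
      have := hmem y
      rwa [← Nat.cofinite_eq_atTop] at this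
    refine (hfin.image W).subset ?_
    rintro _ ⟨⟨n, rfl⟩, hn⟩
    exact mem_image_of_mem W hn

theorem hurewicz_linearly_sigma_additive {α : Type*} [TopologicalSpace α] (X : ℕ → Set α)
    (hmono : ∀ n, X n ⊆ X (n + 1))
    (h : ∀ n, Ufin (X n) (IsGammaCoverOf (X n))) :
    Ufin (⋃ n, X n) (IsGammaCoverOf (⋃ n, X n)) := by
  intro 𝒰 h𝒰
  choose F hF hmem using fun k => exists_finite_subfamilies_eventually_mem (h k)
    (continuous_inclusion (subset_iUnion X k)) fun n => (h𝒰 n).1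
  have hsub : ∀ n, (⋃ k ∈ Iic n, F k n) ⊆ 𝒰 n := fun n => iUnion₂_subset fun k _ => (hF k n).1
  have hfin : ∀ n, (⋃ k ∈ Iic n, F k n).Finite := fun n =>
    (finite_Iic n).biUnion fun k _ => (hF k n).2
  refine ⟨fun n => ⋃ k ∈ Iic n, F k n, fun n => ⟨hsub n, hfin n⟩, isGammaCoverOf_range
    (fun n => isOpen_sUnion fun U hU => (h𝒰 n).1.1 U (hsub n hU))
    (fun n hn => (h𝒰 n).2 ⟨_, hsub n, hfin n, fun y => ?_⟩) fun y => ?_⟩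
  · exact mem_sUnion.1 (hn ▸ mem_univ y)
  · obtain ⟨k, hk⟩ := mem_iUnion.1 y.2
    filter_upwards [hmem k ⟨y, hk⟩, eventually_ge_atTop k] with n hn hkn
    exact sUnion_mono (subset_biUnion_of_mem (u := fun k => F k n) (mem_Iic.2 hkn)) hn
end
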